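/- Fix d ≥ 1 and let W_{a,b} := X^a Z^b (a,b ∈ {0,…,d−1}) be the generalized Pauli operators on ℂ^d. Let ρ be any density matrix on ℂ^d (the message), and model the shared uniform key together with the ciphertext by the classical–quantum state Γ := (1/d²) ∑_{a,b} |(a,b)⟩⟨(a,b)| ⊗ W_{a,b} ρ W_{a,b}† on ℂ^{d²} ⊗ ℂ^d. Then: (i) the reduced ciphertext state is maximally mixed, Tr_K Γ = I/d, independently of ρ (security against an eavesdropper who intercepts the ciphertext but lacks the key); and (ii) for each key value (a,b), decryption is exact: W_{a,b}† (W_{a,b} ρ W_{a,b}†) W_{a,b} = ρ (correctness for the legitimate receiver who holds the key). -/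

import Mathlib

open Matrix ComplexOrder

/-- The `d×d` cyclic shift matrix `X`, with `X_{j,k} = 1` iff `j = k+1 (mod d)`. -/
def shiftX (d : ℕ) : Matrix (Fin d) (Fin d) ℂ :=
  fun j k => if (j : ℕ) = ((k : ℕ) + 1) % d then 1 else 0

/-- The clock matrix `Z = diag(1, ω, ω², …, ω^{d−1})` with `ω = exp(2πi/d)`. -/
noncomputable def clockZ (d : ℕ) : Matrix (Fin d) (Fin d) ℂ :=
  Matrix.diagonal fun j => Complex.exp (2 * Real.pi * Complex.I / d) ^ (j : ℕ)

/-- The generalized Pauli (Weyl) operators `W_{a,b} = X^a Z^b`. -/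
noncomputable def weylW (d : ℕ) (a b : Fin d) : Matrix (Fin d) (Fin d) ℂ :=
  shiftX d ^ (a : ℕ) * clockZ d ^ (b : ℕ)

lemma qotp_shift_pow (n : ℕ) (a : ℕ) (j k : Fin (n+1)) :
    (shiftX (n+1) ^ a) j k = if j = k + Fin.ofNat (n+1) a then 1 else 0 := by
  induction a generalizing j k with
  | zero =>
    have : k + Fin.ofNat (n+1) 0 = k := by ext; simp [Fin.val_add, Nat.mod_eq_of_lt k.2]
    rw [this, pow_zero, Matrix.one_apply]
  | succ a ih =>
    have h1 : ∀ i k : Fin (n+1), shiftX (n+1) i k = if i = k + 1 then 1 else 0 := by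
      intro i k
      unfold shiftX
      congr 1
      rw [Fin.ext_iff, Fin.val_add]
      simp
    have h2 : k + Fin.ofNat (n+1) (a+1) = k + 1 + Fin.ofNat (n+1) a := by
      ext; simp [Fin.val_add]; congr 1; ring
    rw [pow_succ, Matrix.mul_apply, h2]
    simp only [h1, mul_ite, mul_one, mul_zero, Finset.sum_ite_eq', Finset.sum_ite_eq,
      Finset.mem_univ, if_true]
    exact ih _ _

lemma qotp_weyl_apply (n : ℕ) (a b j k : Fin (n+1)) :
    weylW (n+1) a b j k = if k = j - a then
      (Complex.exp (2 * Real.pi * Complex.I / ((n+1 : ℕ) : ℂ)) ^ (k : ℕ)) ^ (b : ℕ) else 0 := by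
  unfold weylW clockZ
  rw [Matrix.diagonal_pow, Matrix.mul_diagonal, qotp_shift_pow]
  have h : Fin.ofNat (n+1) (a : ℕ) = a := by ext; simp [Nat.mod_eq_of_lt a.2]
  rw [h]
  have h' : (j = k + a) ↔ (k = j - a) := by rw [eq_sub_iff_add_eq, eq_comm]
  simp [h']

lemma qotp_conj (n : ℕ) (m : ℕ) :
    (Complex.exp (2 * Real.pi * Complex.I / ((n+1 : ℕ) : ℂ)) ^ m) *
    star (Complex.exp (2 * Real.pi * Complex.I / ((n+1 : ℕ) : ℂ)) ^ m) = 1 := by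
  have hp := Complex.isPrimitiveRoot_exp (n+1) (Nat.succ_ne_zero n)
  have := hp.norm'_eq_one (Nat.succ_ne_zero n)
  rw [Complex.star_def, Complex.mul_conj', norm_pow, this]
  simp

lemma qotp_sum (n : ℕ) (k l : Fin (n+1)) :
    ∑ b : Fin (n+1), (Complex.exp (2 * Real.pi * Complex.I / ((n+1 : ℕ) : ℂ)) ^ (k : ℕ)) ^ (b : ℕ) *
      star ((Complex.exp (2 * Real.pi * Complex.I / ((n+1 : ℕ) : ℂ)) ^ (l : ℕ)) ^ (b : ℕ))
      = if k = l then ((n+1 : ℕ) : ℂ) else 0 := by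
  have hp := Complex.isPrimitiveRoot_exp (n+1) (Nat.succ_ne_zero n)
  have hc := qotp_conj n
  generalize Complex.exp (2 * Real.pi * Complex.I / ((n+1 : ℕ) : ℂ)) = w at hp hc ⊢
  simp only [star_pow _ (Fin.val _), ← mul_pow]
  split_ifs with h
  · subst h
    simp only [← star_pow, hc]; simp
  · rw [Fin.sum_univ_eq_sum_range (fun b => (w ^ (k:ℕ) * star w ^ (l:ℕ)) ^ b) (n+1)]
    set z := w ^ (k:ℕ) * star w ^ (l:ℕ) with hz
    have hz1 : z ^ (n+1) = 1 := by
      rw [hz, mul_pow, ← pow_mul, ← pow_mul, mul_comm (k:ℕ), mul_comm (l:ℕ), pow_mul, pow_mul,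
        ← star_pow, hp.pow_eq_one]; simp
    have hz2 : z ≠ 1 := by
      intro e
      apply h
      have h3 := hc l
      have : w ^ (k:ℕ) = w ^ (l:ℕ) := by
        calc w ^ (k:ℕ) = w ^ (k:ℕ) * (w ^ (l:ℕ) * star (w ^ (l:ℕ))) := by rw [h3, mul_one]
          _ = z * w ^ (l:ℕ) := by rw [hz, star_pow]; ring
          _ = _ := by rw [e, one_mul]
      exact Fin.ext (hp.pow_inj k.2 l.2 this)
    rw [geom_sum_eq hz2, hz1]; simp

lemma qotp_unitary (n : ℕ) (a b : Fin (n+1)) :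
    (weylW (n+1) a b)ᴴ * weylW (n+1) a b = 1 := by
  ext k l
  rw [Matrix.mul_apply, Fintype.sum_eq_single (k + a)]
  · rw [Matrix.conjTranspose_apply, qotp_weyl_apply, qotp_weyl_apply, add_sub_cancel_right,
      if_pos rfl, Matrix.one_apply]
    by_cases h : k = l
    · subst h
      rw [if_pos rfl, if_pos rfl, mul_comm, ← pow_mul, qotp_conj]
    · rw [if_neg (Ne.symm h), if_neg h, mul_zero]
  · intro x hx
    rw [Matrix.conjTranspose_apply, qotp_weyl_apply, if_neg, star_zero, zero_mul]
    rintro rfl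
    simp at hx

lemma qotp_conj_apply (n : ℕ) (ρ : Matrix (Fin (n+1)) (Fin (n+1)) ℂ) (a b q r : Fin (n+1)) :
    (weylW (n+1) a b * ρ * (weylW (n+1) a b)ᴴ) q r = ρ (q - a) (r - a) *
    ((Complex.exp (2 * Real.pi * Complex.I / ((n+1 : ℕ) : ℂ)) ^ ((q - a : Fin (n+1)) : ℕ)) ^ (b : ℕ) *
      star ((Complex.exp (2 * Real.pi * Complex.I / ((n+1 : ℕ) : ℂ)) ^ ((r - a : Fin (n+1)) : ℕ)) ^ (b : ℕ))) := by
  rw [Matrix.mul_apply, Fintype.sum_eq_single (r - a), Matrix.mul_apply,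
    Fintype.sum_eq_single (q - a)]
  · rw [Matrix.conjTranspose_apply, qotp_weyl_apply, qotp_weyl_apply, if_pos rfl, if_pos rfl]
    ring
  · intro x hx
    rw [qotp_weyl_apply, if_neg hx, zero_mul]
  · intro x hx
    rw [Matrix.conjTranspose_apply, qotp_weyl_apply, if_neg hx, star_zero, mul_zero]

/-- The quantum one-time pad: with a uniform `2 log d`-bit key `(a,b)` and the
classical–quantum key–ciphertext state
`Γ = (1/d²) ∑_{a,b} |(a,b)⟩⟨(a,b)| ⊗ W_{a,b} ρ W_{a,b}†`,
(i) the reduced ciphertext `Tr_K Γ` is the maximally mixed state `I/d`,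
independently of the message `ρ` (security), and
(ii) for each key value, conjugating back by `W_{a,b}` recovers `ρ` exactly
(correctness). -/
theorem quantum_one_time_pad_protocol (d : ℕ) (hd : 1 ≤ d)
    (ρ : Matrix (Fin d) (Fin d) ℂ) (hρ : ρ.PosSemidef) (hτ : ρ.trace = 1)
    (Γ : Matrix ((Fin d × Fin d) × Fin d) ((Fin d × Fin d) × Fin d) ℂ)
    (hΓ : Γ = fun kq k'q' =>
      if kq.1 = k'q'.1 then
        ((1 : ℂ) / (d ^ 2)) *
          (weylW d kq.1.1 kq.1.2 * ρ * (weylW d kq.1.1 kq.1.2)ᴴ) kq.2 k'q'.2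
      else 0) :
    -- (i) security: the ciphertext alone is maximally mixed
    (fun q q' => ∑ k : Fin d × Fin d, Γ (k, q) (k, q'))
      = ((d : ℂ))⁻¹ • (1 : Matrix (Fin d) (Fin d) ℂ)
    -- (ii) correctness: decryption with the key is exact
    ∧ ∀ a b : Fin d,
        (weylW d a b)ᴴ * (weylW d a b * ρ * (weylW d a b)ᴴ) * weylW d a b = ρ := by
  obtain ⟨n, rfl⟩ : ∃ n, d = n + 1 := ⟨d - 1, by omega⟩
  constructor
  · ext q r
    subst hΓ
    simp only [if_true, Fintype.sum_prod_type, qotp_conj_apply, ← Finset.mul_sum, qotp_sum]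
    rw [Matrix.smul_apply, Matrix.one_apply]
    have hn : ((n+1 : ℕ) : ℂ) ≠ 0 := Nat.cast_ne_zero.mpr (Nat.succ_ne_zero n)
    by_cases h : q = r
    · subst h
      have : ∑ a : Fin (n+1), ρ (q - a) (q - a) = 1 := by
        rw [← hτ]
        exact (Equiv.subLeft q).sum_comp (fun i => ρ i i)
      simp only [if_true, ← Finset.sum_mul, this, smul_eq_mul]
      field_simp
    · have h' : ∀ a, ¬ (q - a = r - a) := fun a e => h (sub_left_injective e)
      simp [h, h']
  · intro a b
    have h := qotp_unitary n a b
    calc _ = ((weylW (n+1) a b)ᴴ * weylW (n+1) a b) * ρ * ((weylW (n+1) a b)ᴴ * weylW (n+1) a b) := by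
          simp only [Matrix.mul_assoc]
      _ = ρ := by rw [h, Matrix.one_mul, Matrix.mul_one]
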